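/- arXiv:1009.2013 — 7 statements merged into one kernel-verified Lean document; each statement's English description precedes it below -/
import Mathlib

section
/- Let K be a field, let V_1, ..., V_k be finite-dimensional K-vector spaces, and let N be a natural number. Then there is a K-linear equivalence between the N-th exterior power of the direct sum ⨁_{j=1}^k V_j and the direct sum, over all tuples (d_1, ..., d_k) of natural numbers with d_1 + ... + d_k = N, of the tensor products ⨂_{j=1}^k Λ^{d_j} V_j of exterior powers. -/
open DirectSum
open scoped TensorProduct

open Module

/-- The generalized Vandermonde identity, for finitely many summands. -/
theorem Nat.choose_sum_eq_sum_piAntidiag {ι : Type*} [DecidableEq ι] (s : Finset ι) (n : ι → ℕ)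
    (N : ℕ) :
    (∑ i ∈ s, n i).choose N = ∑ d ∈ s.piAntidiag N, ∏ i ∈ s, (n i).choose (d i) := by
  have h (m l : ℕ) :
      PowerSeries.coeff l (((1 + Polynomial.X : Polynomial ℕ) ^ m : Polynomial ℕ) : PowerSeries ℕ) =
        m.choose l := by
    rw [Polynomial.coeff_coe, Polynomial.coeff_one_add_X_pow, Nat.cast_id]
  have hprod := PowerSeries.coeff_prod
    (fun i ↦ (((1 + Polynomial.X : Polynomial ℕ) ^ n i : Polynomial ℕ) : PowerSeries ℕ)) N s
  simp only [h] at hprod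
  rw [← h, ← Finset.prod_pow_eq_pow_sum, ← Polynomial.coeToPowerSeries.ringHom_apply, map_prod]
  simp only [Polynomial.coeToPowerSeries.ringHom_apply, hprod]
  refine Finset.sum_bij (fun d _ ↦ ⇑d) ?_ (fun _ _ _ _ hd ↦ DFunLike.coe_injective hd) ?_
    (fun _ _ ↦ rfl)
  · intro d hd
    rw [Finset.mem_finsuppAntidiag] at hd
    exact Finset.mem_piAntidiag.2 ⟨hd.1, fun i hi ↦ hd.2 (Finsupp.mem_support_iff.2 hi)⟩
  · intro d hd
    rw [Finset.mem_piAntidiag] at hd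
    exact ⟨Finsupp.onFinset s d hd.2, Finset.mem_finsuppAntidiag.2
      ⟨hd.1, Finsupp.support_onFinset_subset⟩, rfl⟩

/-- The dimension of a finite tensor product is the product of the dimensions. -/
theorem PiTensorProduct.finrank_eq_prod {ι R : Type*} [Fintype ι] [CommRing R]
    [StrongRankCondition R] (M : ι → Type*) [∀ i, AddCommGroup (M i)] [∀ i, Module R (M i)]
    [∀ i, Module.Free R (M i)] [∀ i, Module.Finite R (M i)] :
    finrank R (⨂[R] i, M i) = ∏ i, finrank R (M i) := by
  classical
  rw [finrank_eq_card_basis (Basis.piTensorProduct fun i ↦ Module.Free.chooseBasis R (M i)),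
    Fintype.card_pi]
  simp only [finrank_eq_card_chooseBasisIndex]

/-- The N-th exterior power of a finite direct sum of finite-dimensional vector spaces
decomposes as the direct sum, over all tuples `(d 1, ..., d k)` of natural numbers summing
to `N`, of the tensor products of the exterior powers `⋀^(d j) (V j)`. -/
theorem exteriorPower_directSum_equiv
    (K : Type*) [Field K] (k N : ℕ) (V : Fin k → Type*)
    [∀ j, AddCommGroup (V j)] [∀ j, Module K (V j)] [∀ j, FiniteDimensional K (V j)] :
    Nonempty
      ((⋀[K]^N (⨁ j, V j)) ≃ₗ[K]
        ⨁ (d : {d : Fin k → ℕ // ∑ j, d j = N}), ⨂[K] j, ⋀[K]^(d.val j) (V j)) := by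
  classical
  have hmem (d : Fin k → ℕ) : d ∈ Finset.univ.piAntidiag N ↔ ∑ j, d j = N := by simp
  let : Fintype {d : Fin k → ℕ // ∑ j, d j = N} := Fintype.subtype _ hmem
  let b (d : {d : Fin k → ℕ // ∑ j, d j = N}) :=
    Basis.piTensorProduct fun j ↦ Module.Free.chooseBasis K (⋀[K]^(d.val j) (V j))
  have (d : {d : Fin k → ℕ // ∑ j, d j = N}) :
      Module.Free K (⨂[K] j, ⋀[K]^(d.val j) (V j)) := .of_basis (b d)
  have (d : {d : Fin k → ℕ // ∑ j, d j = N}) :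
      Module.Finite K (⨂[K] j, ⋀[K]^(d.val j) (V j)) := .of_basis (b d)
  refine FiniteDimensional.nonempty_linearEquiv_of_finrank_eq ?_
  simp only [finrank_directSum, PiTensorProduct.finrank_eq_prod, exteriorPower.finrank_eq]
  rw [Nat.choose_sum_eq_sum_piAntidiag]
  exact Finset.sum_subtype _ hmem _
end

section
/- Let ℓ_1 ≥ ℓ_2 ≥ 0 be integers and let ℓ be an integer with ℓ_1 − ℓ_2 ≤ ℓ ≤ ℓ_1 + ℓ_2. Then the number of pairs of integers (m, m_1) satisfying |m| ≤ ℓ, |m_1| ≤ ℓ_1, and |m − m_1| ≤ ℓ_2 equals (ℓ_1 + ℓ_2 + 1)(2ℓ + 1) − (ℓ_1 − ℓ_2)² − ℓ(ℓ + 1). -/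
/-- The integers `y` with `|y| ≤ a` and `|x - y| ≤ b` form an interval. -/
theorem card_filter_abs_sub_le (a b x : ℤ) (h : |x| ≤ a + b) (ha : 0 ≤ a) (hb : 0 ≤ b) :
    (((Finset.Icc (-a) a).filter (fun y : ℤ => |x - y| ≤ b)).card : ℤ)
      = min a (x + b) - max (-a) (x - b) + 1 := by
  have hIcc : (Finset.Icc (-a) a).filter (fun y : ℤ => |x - y| ≤ b)
      = Finset.Icc (max (-a) (x - b)) (min a (x + b)) := by
    ext y
    simp only [Finset.mem_filter, Finset.mem_Icc, abs_le]
    omega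
  rw [abs_le] at h
  rw [hIcc, Int.card_Icc]
  omega

/-- Enlarging a symmetric integer interval by one adds its two new endpoints to a sum. -/
theorem sum_Icc_neg_succ (f : ℤ → ℤ) (n : ℤ) (hn : 0 ≤ n) :
    ∑ x ∈ Finset.Icc (-(n + 1)) (n + 1), f x
      = f (n + 1) + f (-(n + 1)) + ∑ x ∈ Finset.Icc (-n) n, f x := by
  have hinsert : Finset.Icc (-(n + 1)) (n + 1)
      = insert (n + 1) (insert (-(n + 1)) (Finset.Icc (-n) n)) := by
    ext x
    simp only [Finset.mem_insert, Finset.mem_Icc]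
    omega
  rw [hinsert, Finset.sum_insert, Finset.sum_insert, add_assoc]
  · simp only [Finset.mem_Icc]
    omega
  · simp only [Finset.mem_insert, Finset.mem_Icc]
    omega

theorem sum_Icc_min_sub_max (a b n : ℤ) (hab : b ≤ a) (hn : a - b ≤ n) :
    n ≤ a + b → ∑ x ∈ Finset.Icc (-n) n, (min a (x + b) - max (-a) (x - b) + 1)
      = (a + b + 1) * (2 * n + 1) - (a - b) ^ 2 - n * (n + 1) := by
  induction n, hn using Int.leInduction with
  | base =>
    intro _
    have hconst : ∀ x ∈ Finset.Icc (-(a - b)) (a - b),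
        min a (x + b) - max (-a) (x - b) + 1 = 2 * b + 1 := by
      intro x hx
      rw [Finset.mem_Icc] at hx
      omega
    rw [Finset.sum_congr rfl hconst, Finset.sum_const, Int.card_Icc, nsmul_eq_mul,
      Int.toNat_of_nonneg (by omega)]
    ring
  | succ n hn ih =>
    intro hle
    have hpos : min a (n + 1 + b) - max (-a) (n + 1 - b) + 1 = a + b - n := by omega
    have hneg : min a (-(n + 1) + b) - max (-a) (-(n + 1) - b) + 1 = a + b - n := by omega
    rw [sum_Icc_neg_succ _ n (by omega), ih (by omega), hpos, hneg]
    ring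

/-- Counting Clebsch–Gordan coefficients: for integers `ℓ₁ ≥ ℓ₂ ≥ 0` and
`ℓ₁ - ℓ₂ ≤ ℓ ≤ ℓ₁ + ℓ₂`, the number of pairs of integers `(m, m₁)` with `|m| ≤ ℓ`,
`|m₁| ≤ ℓ₁` and `|m - m₁| ≤ ℓ₂` equals `(ℓ₁+ℓ₂+1)(2ℓ+1) - (ℓ₁-ℓ₂)² - ℓ(ℓ+1)`. -/
theorem numCG_card (ℓ₁ ℓ₂ ℓ : ℤ) (h₂ : 0 ≤ ℓ₂) (h₁₂ : ℓ₂ ≤ ℓ₁)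
    (hlo : ℓ₁ - ℓ₂ ≤ ℓ) (hhi : ℓ ≤ ℓ₁ + ℓ₂) :
    (((Finset.Icc (-ℓ) ℓ ×ˢ Finset.Icc (-ℓ₁) ℓ₁).filter
        (fun p : ℤ × ℤ => |p.1 - p.2| ≤ ℓ₂)).card : ℤ)
      = (ℓ₁ + ℓ₂ + 1) * (2 * ℓ + 1) - (ℓ₁ - ℓ₂) ^ 2 - ℓ * (ℓ + 1) := by
  rw [Finset.card_filter, Finset.sum_product]
  simp only [← Finset.card_filter]
  push_cast
  rw [← sum_Icc_min_sub_max ℓ₁ ℓ₂ ℓ h₁₂ hlo hhi]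
  refine Finset.sum_congr rfl fun x hx => ?_
  rw [Finset.mem_Icc] at hx
  exact card_filter_abs_sub_le ℓ₁ ℓ₂ x (abs_le.2 (by omega)) (h₂.trans h₁₂) h₂
end

section
/- Let ℓ_1 ≥ ℓ_2 ≥ 0 be integers. Then ∑_{ℓ = ℓ_1 − ℓ_2}^{ℓ_1 + ℓ_2} [(ℓ_1 + ℓ_2 + 1)(2ℓ + 1) − (ℓ_1 − ℓ_2)² − ℓ(ℓ + 1)] = (2ℓ_2 + 1)·[(2ℓ_1 + 1)(2ℓ_2 + 1) − ((2ℓ_2 + 1)² − 1)/3], and this quantity is at most (2ℓ_2 + 1)·(2ℓ_1 + 1)(2ℓ_2 + 1). -/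
/-- Telescoping sum over an integer interval. -/
theorem sum_Icc_int_sub {G : Type*} [AddCommGroup G] (f : ℤ → G) {a b : ℤ} (hab : a ≤ b) :
    ∑ i ∈ Finset.Icc a b, (f (i + 1) - f i) = f (b + 1) - f a := by
  induction b, hab using Int.leInduction with
  | base => simp
  | succ b hab ih =>
    have h : Finset.Icc a (b + 1) = insert (b + 1) (Finset.Icc a b) := by
      ext i
      simp only [Finset.mem_Icc, Finset.mem_insert]
      lia
    rw [h, Finset.sum_insert (by simp), ih]
    abel

/-- Summing the Clebsch–Gordan coefficient count `num_CG(V_{12,ℓ})` over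
`ℓ = ℓ₁ - ℓ₂, ..., ℓ₁ + ℓ₂` gives
`(2ℓ₂+1)·[(2ℓ₁+1)(2ℓ₂+1) - ((2ℓ₂+1)² - 1)/3]`, which is bounded by
`(2ℓ₂+1)` times the dimension `(2ℓ₁+1)(2ℓ₂+1)` of the tensor product. -/
theorem sum_numCG (ℓ₁ ℓ₂ : ℤ) (h₂ : 0 ≤ ℓ₂) (h₁₂ : ℓ₂ ≤ ℓ₁) :
    (∑ ℓ ∈ Finset.Icc (ℓ₁ - ℓ₂) (ℓ₁ + ℓ₂),
        (((ℓ₁ + ℓ₂ + 1) * (2 * ℓ + 1) - (ℓ₁ - ℓ₂) ^ 2 - ℓ * (ℓ + 1) : ℤ) : ℚ))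
      = (2 * ℓ₂ + 1) * ((2 * ℓ₁ + 1) * (2 * ℓ₂ + 1) - ((2 * ℓ₂ + 1) ^ 2 - 1) / 3)
    ∧ (∑ ℓ ∈ Finset.Icc (ℓ₁ - ℓ₂) (ℓ₁ + ℓ₂),
        (((ℓ₁ + ℓ₂ + 1) * (2 * ℓ + 1) - (ℓ₁ - ℓ₂) ^ 2 - ℓ * (ℓ + 1) : ℤ) : ℚ))
      ≤ (2 * ℓ₂ + 1) * ((2 * ℓ₁ + 1) * (2 * ℓ₂ + 1)) := by
  have hsum : (∑ ℓ ∈ Finset.Icc (ℓ₁ - ℓ₂) (ℓ₁ + ℓ₂),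
        (((ℓ₁ + ℓ₂ + 1) * (2 * ℓ + 1) - (ℓ₁ - ℓ₂) ^ 2 - ℓ * (ℓ + 1) : ℤ) : ℚ))
      = (2 * ℓ₂ + 1) * ((2 * ℓ₁ + 1) * (2 * ℓ₂ + 1) - ((2 * ℓ₂ + 1) ^ 2 - 1) / 3) := by
    let F : ℤ → ℚ := fun ℓ =>
      (ℓ₁ + ℓ₂ + 1) * ℓ ^ 2 - (ℓ₁ - ℓ₂) ^ 2 * ℓ - (ℓ - 1) * ℓ * (ℓ + 1) / 3
    trans ∑ ℓ ∈ Finset.Icc (ℓ₁ - ℓ₂) (ℓ₁ + ℓ₂), (F (ℓ + 1) - F ℓ)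
    · refine Finset.sum_congr rfl fun ℓ _ => ?_
      simp only [F]
      push_cast
      ring
    · rw [sum_Icc_int_sub F (by lia)]
      simp only [F]
      push_cast
      ring
  refine ⟨hsum, hsum.trans_le ?_⟩
  have h : (0 : ℚ) ≤ ℓ₂ := by exact_mod_cast h₂
  gcongr
  nlinarith
end

section
/- Let ℓ ≥ 0 be an integer, λ > 0 real, and let c = (c_0, ..., c_p) and c' = (c'_0, ..., c'_q) be tuples of complex numbers. Then ∫_0^∞ conj(∑_{i=0}^p c_i r^i) · (∑_{j=0}^q c'_j r^j) · r^{2ℓ+2} e^{−λ r} dr = ∑_{i=0}^p ∑_{j=0}^q conj(c_i) c'_j (i + j + 2ℓ + 2)! / λ^{i + j + 2ℓ + 3}. -/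
open MeasureTheory

theorem integral_ofReal_pow_mul_cexp_neg_mul_Ioi {b : ℝ} (hb : 0 < b) (n : ℕ) :
    ∫ r in Set.Ioi (0 : ℝ), (r : ℂ) ^ n * Complex.exp (-b * r)
      = (Nat.factorial n : ℂ) / (b : ℂ) ^ (n + 1) := by
  have h := Complex.integral_cpow_mul_exp_neg_mul_Ioi (a := (n : ℂ) + 1)
    (by simp; positivity) hb
  rw [Complex.Gamma_nat_eq_factorial] at h
  simp only [add_sub_cancel_right, Complex.cpow_natCast, ← neg_mul] at h
  rw [h, ← Nat.cast_succ, Complex.cpow_natCast, one_div, inv_pow, div_eq_inv_mul]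

theorem integrableOn_ofReal_pow_mul_cexp_neg_mul_Ioi {b : ℝ} (hb : 0 < b) (n : ℕ) :
    IntegrableOn (fun r : ℝ => (r : ℂ) ^ n * Complex.exp (-b * r)) (Set.Ioi 0) := by
  refine not_imp_comm.1 integral_undef ?_
  rw [integral_ofReal_pow_mul_cexp_neg_mul_Ioi hb]
  exact div_ne_zero (Nat.cast_ne_zero.2 n.factorial_ne_zero)
    (pow_ne_zero _ (Complex.ofReal_ne_zero.2 hb.ne.symm))

/-- The radial inner product of two Slater-type orbitals with common angular momentum `ℓ`
is the Hankel quadratic form of their coefficient vectors: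
`∫_0^∞ conj(∑ᵢ cᵢ rⁱ) (∑ⱼ c'ⱼ rʲ) r^(2ℓ+2) e^(-λ r) dr
  = ∑ᵢ ∑ⱼ conj(cᵢ) c'ⱼ (i+j+2ℓ+2)! / λ^(i+j+2ℓ+3)`. -/
theorem slater_radial_inner_hankel (ℓ : ℕ) (lam : ℝ) (hlam : 0 < lam)
    (p q : ℕ) (c : Fin (p + 1) → ℂ) (c' : Fin (q + 1) → ℂ) :
    ∫ r in Set.Ioi (0 : ℝ),
        (starRingEnd ℂ) (∑ i : Fin (p + 1), c i * (r : ℂ) ^ (i : ℕ)) *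
          (∑ j : Fin (q + 1), c' j * (r : ℂ) ^ (j : ℕ)) *
          (r : ℂ) ^ (2 * ℓ + 2) * Complex.exp (-lam * r)
      = ∑ i : Fin (p + 1), ∑ j : Fin (q + 1),
          (starRingEnd ℂ) (c i) * c' j *
            ((Nat.factorial ((i : ℕ) + (j : ℕ) + 2 * ℓ + 2) : ℂ) /
              (lam : ℂ) ^ ((i : ℕ) + (j : ℕ) + 2 * ℓ + 3)) := by
  have expand (r : ℝ) :
      (starRingEnd ℂ) (∑ i : Fin (p + 1), c i * (r : ℂ) ^ (i : ℕ)) *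
          (∑ j : Fin (q + 1), c' j * (r : ℂ) ^ (j : ℕ)) *
          (r : ℂ) ^ (2 * ℓ + 2) * Complex.exp (-lam * r)
        = ∑ i : Fin (p + 1), ∑ j : Fin (q + 1), (starRingEnd ℂ) (c i) * c' j *
            ((r : ℂ) ^ ((i : ℕ) + (j : ℕ) + 2 * ℓ + 2) * Complex.exp (-lam * r)) := by
    simp only [map_sum, map_mul, map_pow, Complex.conj_ofReal]
    rw [Finset.sum_mul_sum]
    simp only [Finset.sum_mul]
    refine Finset.sum_congr rfl fun i _ => Finset.sum_congr rfl fun j _ => ?_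
    ring
  have integrable (i : Fin (p + 1)) (j : Fin (q + 1)) :=
    (integrableOn_ofReal_pow_mul_cexp_neg_mul_Ioi hlam
      ((i : ℕ) + (j : ℕ) + 2 * ℓ + 2)).const_mul ((starRingEnd ℂ) (c i) * c' j)
  simp_rw [expand]
  rw [integral_finsetSum _ fun i _ => integrable_finsetSum _ fun j _ => integrable i j]
  refine Finset.sum_congr rfl fun i _ => ?_
  rw [integral_finsetSum _ fun j _ => integrable i j]
  refine Finset.sum_congr rfl fun j _ => ?_
  rw [integral_const_mul, integral_ofReal_pow_mul_cexp_neg_mul_Ioi hlam]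
end

section
/- Let ℓ ≥ 0 be an integer and let (μ_n)_{n ≥ ℓ+1} be a sequence of positive real numbers. Then there exist real polynomials q_n (for n ≥ ℓ+1), with q_n nonzero and of degree at most n − ℓ − 1, such that the functions R_n(r) = r^ℓ q_n(r) e^{−μ_n r} on (0, ∞) satisfy ∫_0^∞ R_n(r) R_m(r) r² dr = 0 whenever n ≠ m, and ∫_0^∞ R_n(r)² r² dr > 0 for every n. -/
open MeasureTheory

open Polynomial in
/-- Any `k` linear functionals on real polynomials have a common nonzero zero of degree at most
`k`. -/
theorem exists_polynomial_ne_zero_forall_eq_zero (k : ℕ) (φ : Fin k → ℝ[X] →ₗ[ℝ] ℝ) :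
    ∃ p : ℝ[X], p ≠ 0 ∧ p.natDegree ≤ k ∧ ∀ i, φ i p = 0 := by
  let F : (Fin (k + 1) → ℝ) →ₗ[ℝ] (Fin k → ℝ) :=
    (LinearMap.pi φ) ∘ₗ (degreeLT ℝ (k + 1)).subtype ∘ₗ
      (degreeLTEquiv ℝ (k + 1)).symm.toLinearMap
  have hF : LinearMap.ker F ≠ ⊥ := F.ker_ne_bot_of_finrank_lt (by simp)
  obtain ⟨v, hv, hv0⟩ := (Submodule.ne_bot_iff _).mp hF
  refine ⟨(degreeLTEquiv ℝ (k + 1)).symm v, by simpa using hv0, ?_, fun i => ?_⟩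
  · have h := mem_degreeLT.mp ((degreeLTEquiv ℝ (k + 1)).symm v).2
    exact natDegree_le_of_degree_le (Order.lt_succ_iff.mp h)
  · exact congrFun (LinearMap.mem_ker.mp hv) i

open Polynomial in
/-- A sequence of nonzero polynomials, the `k`-th of degree at most `k`, each annihilated by the
functionals that `L` attaches to its predecessors. -/
noncomputable def orthogonalSeq (L : ℕ → ℕ → ℝ[X] → ℝ[X] →ₗ[ℝ] ℝ) (k : ℕ) : ℝ[X] :=
  Classical.choose (exists_polynomial_ne_zero_forall_eq_zero k
    fun i : Fin k => L k i (orthogonalSeq L i))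
termination_by k
decreasing_by all_goals exact i.2

open Polynomial in
theorem orthogonalSeq_spec (L : ℕ → ℕ → ℝ[X] → ℝ[X] →ₗ[ℝ] ℝ) (k : ℕ) :
    orthogonalSeq L k ≠ 0 ∧ (orthogonalSeq L k).natDegree ≤ k ∧
      ∀ i < k, L k i (orthogonalSeq L i) (orthogonalSeq L k) = 0 := by
  have h := Classical.choose_spec (exists_polynomial_ne_zero_forall_eq_zero k
    fun i : Fin k => L k i (orthogonalSeq L i))
  rw [← orthogonalSeq] at h
  exact ⟨h.1, h.2.1, fun i hi => h.2.2 ⟨i, hi⟩⟩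

open Polynomial in
theorem integrableOn_eval_mul_exp_neg (p : ℝ[X]) {c : ℝ} (hc : 0 < c) :
    IntegrableOn (fun r : ℝ => p.eval r * Real.exp (-c * r)) (Set.Ioi 0) := by
  induction p using Polynomial.induction_on' with
  | add p q hp hq =>
    simp only [eval_add, add_mul]
    exact hp.add hq
  | monomial n a =>
    have h := (integrableOn_rpow_mul_exp_neg_mul_rpow (p := 1) (s := n)
      (by linarith [n.cast_nonneg (α := ℝ)]) one_pos hc).const_mul a
    simpa [IntegrableOn, mul_assoc] using h

open Polynomial in
/-- Integration of polynomials on `(0, ∞)` against the weight `exp (-c r)`. -/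
noncomputable def expIntegral {c : ℝ} (hc : 0 < c) : ℝ[X] →ₗ[ℝ] ℝ where
  toFun p := ∫ r in Set.Ioi (0 : ℝ), p.eval r * Real.exp (-c * r)
  map_add' p q := by
    simp only [eval_add, add_mul]
    exact integral_add (integrableOn_eval_mul_exp_neg p hc) (integrableOn_eval_mul_exp_neg q hc)
  map_smul' a p := by
    simp only [eval_smul, smul_eq_mul, mul_assoc, integral_const_mul, RingHom.id_apply]

open Polynomial in
theorem expIntegral_sq_pos {c : ℝ} (hc : 0 < c) {p : ℝ[X]} (hp : p ≠ 0) :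
    0 < expIntegral hc (p ^ 2) := by
  refine (setIntegral_pos_iff_support_of_nonneg_ae (Filter.Eventually.of_forall fun r => ?_)
    (integrableOn_eval_mul_exp_neg _ hc)).mpr ?_
  · simp only [eval_pow, Pi.zero_apply]
    positivity
  · have hsub : Set.Ioi (0 : ℝ) \ (p.roots.toFinset : Set ℝ) ⊆
        (Function.support fun r => (p ^ 2).eval r * Real.exp (-c * r)) ∩ Set.Ioi 0 := by
      rintro r ⟨hr, hr'⟩
      refine ⟨?_, hr⟩
      simpa [hp, Real.exp_ne_zero] using hr'
    refine lt_of_lt_of_le ?_ (measure_mono hsub)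
    rw [measure_sdiff_null (p.roots.toFinset.finite_toSet.measure_zero volume)]
    simp

open Polynomial in
theorem integral_slater_mul_slater (ℓ : ℕ) {a b : ℝ} (h : 0 < a + b) (p q : ℝ[X]) :
    ∫ r in Set.Ioi (0 : ℝ), (r ^ ℓ * p.eval r * Real.exp (-a * r)) *
      (r ^ ℓ * q.eval r * Real.exp (-b * r)) * r ^ 2 =
    expIntegral h ((X ^ (ℓ + 1)) ^ 2 * q * p) := by
  refine integral_congr_ae (Filter.Eventually.of_forall fun r => ?_)
  have he : Real.exp (-(a + b) * r) = Real.exp (-a * r) * Real.exp (-b * r) := by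
    rw [← Real.exp_add]; ring_nf
  simp only [eval_mul, eval_pow, eval_X, he]
  ring

/-- Orthogonalization of Slater-type radial orbitals: given an angular momentum `ℓ` and
positive exponents `μ n` for `n ≥ ℓ + 1`, there exist nonzero real polynomials `q n` of
degree at most `n - ℓ - 1` such that the radial functions
`R n r = r^ℓ q n(r) e^(-μ n · r)` are pairwise orthogonal in `L²((0,∞), r² dr)` and
each has strictly positive norm. -/
theorem slater_radial_orthogonalization (ℓ : ℕ) (μ : ℕ → ℝ)
    (hμ : ∀ n, ℓ + 1 ≤ n → 0 < μ n) :
    ∃ q : ℕ → Polynomial ℝ,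
      (∀ n, ℓ + 1 ≤ n → q n ≠ 0 ∧ (q n).natDegree ≤ n - ℓ - 1) ∧
      (∀ n m, ℓ + 1 ≤ n → ℓ + 1 ≤ m → n ≠ m →
        ∫ r in Set.Ioi (0 : ℝ),
            (r ^ ℓ * (q n).eval r * Real.exp (-μ n * r)) *
              (r ^ ℓ * (q m).eval r * Real.exp (-μ m * r)) * r ^ 2 = 0) ∧
      (∀ n, ℓ + 1 ≤ n →
        0 < ∫ r in Set.Ioi (0 : ℝ),
            (r ^ ℓ * (q n).eval r * Real.exp (-μ n * r)) ^ 2 * r ^ 2) := by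
  have hpos : ∀ n, 0 < μ (ℓ + 1 + n) := fun n => hμ _ (Nat.le_add_right _ _)
  let L : ℕ → ℕ → Polynomial ℝ → Polynomial ℝ →ₗ[ℝ] ℝ := fun k i p =>
    expIntegral (add_pos (hpos k) (hpos i)) ∘ₗ
      LinearMap.mulLeft ℝ ((Polynomial.X ^ (ℓ + 1)) ^ 2 * p)
  have horth : ∀ n m, ℓ + 1 ≤ m → m < n →
      ∫ r in Set.Ioi (0 : ℝ),
        (r ^ ℓ * (orthogonalSeq L (n - ℓ - 1)).eval r * Real.exp (-μ n * r)) *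
          (r ^ ℓ * (orthogonalSeq L (m - ℓ - 1)).eval r * Real.exp (-μ m * r)) * r ^ 2 = 0 := by
    intro n m hm hmn
    obtain ⟨i, rfl⟩ := Nat.exists_eq_add_of_le hm
    obtain ⟨k, rfl⟩ := Nat.exists_eq_add_of_le (hm.trans hmn.le)
    simp only [Nat.sub_sub, Nat.add_sub_cancel_left]
    rw [integral_slater_mul_slater ℓ (add_pos (hpos k) (hpos i))]
    exact (orthogonalSeq_spec L k).2.2 i (by omega)
  refine ⟨fun n => orthogonalSeq L (n - ℓ - 1), fun n _ => ?_, fun n m hn hm hnm => ?_,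
    fun n hn => ?_⟩
  · exact ⟨(orthogonalSeq_spec L _).1, (orthogonalSeq_spec L _).2.1⟩
  · rcases hnm.lt_or_gt with h | h
    · refine (integral_congr_ae (Filter.Eventually.of_forall fun r => ?_)).trans (horth m n hn h)
      ring
    · exact horth n m hm h
  · simp only [sq (_ * Real.exp _)]
    rw [integral_slater_mul_slater ℓ (add_pos (hμ n hn) (hμ n hn)), mul_assoc, ← sq, ← mul_pow]
    exact expIntegral_sq_pos _
      (mul_ne_zero (pow_ne_zero _ Polynomial.X_ne_zero) (orthogonalSeq_spec L _).1)
end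

section
/- For every real λ > 0 and every k ∈ ℝ³, the integral ∫_{ℝ³} e^{−λ|x|} e^{−i k·x} dx converges absolutely and equals 8πλ / (λ² + |k|²)². -/
open MeasureTheory Real
open scoped RealInnerProductSpace

open Filter Set Topology in
/-- Integrability of a polynomial of degree one times a decaying complex exponential. -/
theorem integrableOn_affine_mul_cexp_neg_mul_Ioi {z : ℂ} (hz : 0 < z.re) (a b : ℂ) :
    IntegrableOn (fun t : ℝ => (a * t + b) * Complex.exp (-z * t)) (Ioi 0) := by
  have key : ∀ s : ℕ, IntegrableOn (fun t : ℝ => (t : ℂ) ^ s * Complex.exp (-z * t)) (Ioi 0) := by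
    intro s
    have h := integrableOn_rpow_mul_exp_neg_mul_rpow (s := s) (p := 1) (b := z.re)
      (by linarith [s.cast_nonneg (α := ℝ)]) one_pos hz
    refine Integrable.mono' h (by fun_prop) ?_
    filter_upwards [ae_restrict_mem measurableSet_Ioi] with t ht
    simp [Complex.norm_exp, abs_of_pos (mem_Ioi.mp ht)]
  refine (((key 1).const_mul a).add ((key 0).const_mul b)).congr (ae_of_all _ fun t => ?_)
  simp only [Pi.add_apply, pow_one, pow_zero]
  ring

open Filter Set Topology in
theorem tendsto_affine_mul_cexp_neg_mul_atTop {z : ℂ} (hz : 0 < z.re) (a b : ℂ) :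
    Tendsto (fun t : ℝ => (a * t + b) * Complex.exp (-z * t)) atTop (𝓝 0) := by
  have key : ∀ s : ℕ, Tendsto (fun t : ℝ => (t : ℂ) ^ s * Complex.exp (-z * t)) atTop (𝓝 0) := by
    intro s
    rw [tendsto_zero_iff_norm_tendsto_zero]
    refine (tendsto_rpow_mul_exp_neg_mul_atTop_nhds_zero s z.re hz).congr' ?_
    filter_upwards [eventually_gt_atTop 0] with t ht
    simp [Complex.norm_exp, abs_of_pos ht]
  have h := ((key 1).const_mul a).add ((key 0).const_mul b)
  simp only [mul_zero, add_zero] at h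
  refine h.congr fun t => ?_
  ring

open Filter Set Topology in
theorem integral_affine_mul_cexp_neg_mul_Ioi {z : ℂ} (hz : 0 < z.re) (a b : ℂ) :
    ∫ t in Ioi (0 : ℝ), (a * t + b) * Complex.exp (-z * t) = a / z ^ 2 + b / z := by
  have hz0 : z ≠ 0 := by rintro rfl; simp at hz
  have hd : ∀ t ∈ Ici (0 : ℝ), HasDerivAt
      (fun t : ℝ => ((-a / z) * t + (-a / z ^ 2 - b / z)) * Complex.exp (-z * t))
      ((a * t + b) * Complex.exp (-z * t)) t := by
    intro t _
    have h1 : HasDerivAt (fun t : ℝ => (t : ℂ)) 1 t := Complex.ofRealCLM.hasDerivAt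
    have h2 := ((h1.const_mul (-a / z)).add_const (-a / z ^ 2 - b / z)).mul
      ((h1.const_mul (-z)).cexp)
    refine h2.congr_deriv ?_
    field_simp
    ring
  rw [integral_Ioi_of_hasDerivAt_of_tendsto' hd (integrableOn_affine_mul_cexp_neg_mul_Ioi hz a b)
    (tendsto_affine_mul_cexp_neg_mul_atTop hz _ _)]
  simp
  ring

open Filter Set Topology in
/-- The integral of `e^(-λ√(t² + |y|²))` over the plane. -/
theorem integral_exp_neg_mul_sqrt_sq_add_norm_sq {lam : ℝ} (hlam : 0 < lam) (t : ℝ) :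
    ∫ y : EuclideanSpace ℝ (Fin 2), Real.exp (-lam * √(t ^ 2 + ‖y‖ ^ 2)) =
      2 * π * ((|t| / lam + 1 / lam ^ 2) * Real.exp (-lam * |t|)) := by
  have hlim : Tendsto (fun u : ℝ => -(u / lam + 1 / lam ^ 2) * Real.exp (-lam * u))
      atTop (𝓝 0) := by
    have h := (Complex.continuous_re.tendsto 0).comp
      (tendsto_affine_mul_cexp_neg_mul_atTop (z := lam) (by simpa using hlam)
        ((-1 / lam : ℝ) : ℂ) ((-1 / lam ^ 2 : ℝ) : ℂ))
    rw [Complex.zero_re] at h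
    refine h.congr fun u => ?_
    simp only [Function.comp_apply]
    rw [← Complex.ofReal_re (-(u / lam + 1 / lam ^ 2) * Real.exp (-lam * u))]
    congr 1
    push_cast
    ring
  have hsqrt : Tendsto (fun r : ℝ => √(t ^ 2 + r ^ 2)) atTop atTop :=
    tendsto_atTop_mono (fun r => Real.le_sqrt_of_sq_le (by simp [sq_nonneg t])) tendsto_id
  have hder : ∀ r ∈ Ioi (0 : ℝ), HasDerivAt
      (fun r : ℝ => -(√(t ^ 2 + r ^ 2) / lam + 1 / lam ^ 2) * Real.exp (-lam * √(t ^ 2 + r ^ 2)))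
      (r * Real.exp (-lam * √(t ^ 2 + r ^ 2))) r := by
    intro r hr
    have hpos : 0 < t ^ 2 + r ^ 2 := by
      have : 0 < r := hr
      positivity
    have hs : 0 < √(t ^ 2 + r ^ 2) := Real.sqrt_pos.mpr hpos
    have h1 := (((hasDerivAt_id r).pow 2).const_add (t ^ 2)).sqrt hpos.ne'
    have h2 := ((h1.div_const lam).add_const (1 / lam ^ 2)).neg.mul ((h1.const_mul (-lam)).exp)
    refine h2.congr_deriv ?_
    simp only [Pi.neg_apply, Pi.pow_apply, id_eq]
    field_simp
    ring
  have hrad : ∫ r in Ioi (0 : ℝ), r * Real.exp (-lam * √(t ^ 2 + r ^ 2)) =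
      (|t| / lam + 1 / lam ^ 2) * Real.exp (-lam * |t|) := by
    rw [integral_Ioi_of_hasDerivAt_of_nonneg (Continuous.continuousWithinAt (by fun_prop)) hder
      (fun r hr => mul_nonneg (le_of_lt hr) (Real.exp_pos _).le) (hlim.comp hsqrt)]
    simp [Real.sqrt_sq_eq_abs]
    ring
  rw [integral_fun_norm_addHaar volume (fun r : ℝ => Real.exp (-lam * √(t ^ 2 + r ^ 2)))]
  simp [Measure.real, Real.pi_pos.le] at hrad ⊢
  rw [hrad]
  ring

open Set in
theorem integrable_exp_neg_mul_norm {lam : ℝ} (hlam : 0 < lam) :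
    Integrable (fun x : EuclideanSpace ℝ (Fin 3) => Real.exp (-lam * ‖x‖)) := by
  rw [integrable_fun_norm_addHaar volume (f := fun r : ℝ => Real.exp (-lam * r))]
  refine (integrableOn_rpow_mul_exp_neg_mul_rpow (s := 2) (p := 1) (b := lam)
    (by norm_num) one_pos hlam).congr_fun (fun t _ => ?_) measurableSet_Ioi
  simp

/-- Two vectors of equal norm in Euclidean spaces of the same dimension are matched by a linear
isometric equivalence. -/
theorem exists_linearIsometryEquiv_apply_eq {E F : Type*}
    [NormedAddCommGroup E] [InnerProductSpace ℝ E] [FiniteDimensional ℝ E]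
    [NormedAddCommGroup F] [InnerProductSpace ℝ F] [FiniteDimensional ℝ F]
    (hdim : Module.finrank ℝ E = Module.finrank ℝ F) {v : E} {w : F} (h : ‖v‖ = ‖w‖) :
    ∃ e : E ≃ₗᵢ[ℝ] F, e v = w := by
  let e : E ≃ₗᵢ[ℝ] F :=
    ((stdOrthonormalBasis ℝ E).reindex (finCongr hdim)).equiv (stdOrthonormalBasis ℝ F)
      (Equiv.refl _)
  exact ⟨e.trans (Submodule.reflection (ℝ ∙ (e v - w))ᗮ), Submodule.reflection_sub (by simpa)⟩

open Set in
theorem integral_abs_mul_exp_neg_mul_abs_mul_cexp {lam : ℝ} (hlam : 0 < lam) (κ : ℝ) :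
    ∫ t : ℝ, (((|t| / lam + 1 / lam ^ 2) * Real.exp (-lam * |t|) : ℝ) : ℂ) *
      Complex.exp (-Complex.I * (κ * t : ℝ)) = 4 * lam / (lam ^ 2 + κ ^ 2) ^ 2 := by
  set F : ℝ → ℂ := fun t => (((|t| / lam + 1 / lam ^ 2) * Real.exp (-lam * |t|) : ℝ) : ℂ) *
      Complex.exp (-Complex.I * (κ * t : ℝ)) with hF
  have hz₁ : 0 < ((lam : ℂ) + Complex.I * κ).re := by simpa using hlam
  have hz₂ : 0 < ((lam : ℂ) - Complex.I * κ).re := by simpa using hlam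
  have h₁ : EqOn F (fun t : ℝ => (1 / lam * t + 1 / lam ^ 2) *
      Complex.exp (-(lam + Complex.I * κ) * t)) (Ioi 0) := by
    intro t ht
    simp only [hF, abs_of_pos (mem_Ioi.mp ht)]
    push_cast
    rw [mul_assoc, ← Complex.exp_add]
    ring_nf
  have h₂ : EqOn (fun t => F (-t)) (fun t : ℝ => (1 / lam * t + 1 / lam ^ 2) *
      Complex.exp (-(lam - Complex.I * κ) * t)) (Ioi 0) := by
    intro t ht
    simp only [hF, abs_neg, abs_of_pos (mem_Ioi.mp ht)]
    push_cast
    rw [mul_assoc, ← Complex.exp_add]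
    ring_nf
  have hi₁ := (integrableOn_congr_fun h₁ measurableSet_Ioi).mpr
    (integrableOn_affine_mul_cexp_neg_mul_Ioi hz₁ _ _)
  have hi₂ := (integrableOn_congr_fun h₂ measurableSet_Ioi).mpr
    (integrableOn_affine_mul_cexp_neg_mul_Ioi hz₂ _ _)
  have hi₃ : IntegrableOn F (Iic 0) := by
    rw [← integrableOn_Ici_iff_integrableOn_Ioi] at hi₂
    simpa using hi₂.comp_neg
  rw [← intervalIntegral.integral_Iic_add_Ioi hi₃ hi₁, setIntegral_congr_fun measurableSet_Ioi h₁,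
    integral_affine_mul_cexp_neg_mul_Ioi hz₁, ← neg_zero, ← integral_comp_neg_Ioi,
    setIntegral_congr_fun measurableSet_Ioi h₂, integral_affine_mul_cexp_neg_mul_Ioi hz₂]
  have hl : (lam : ℂ) ≠ 0 := by exact_mod_cast hlam.ne'
  have hn₁ : (lam : ℂ) + Complex.I * κ ≠ 0 := fun h => by simp [h] at hz₁
  have hn₂ : (lam : ℂ) - Complex.I * κ ≠ 0 := fun h => by simp [h] at hz₂
  have hD : (lam : ℂ) ^ 2 + κ ^ 2 = (lam + Complex.I * κ) * (lam - Complex.I * κ) := by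
    linear_combination (κ : ℂ) ^ 2 * Complex.I_sq
  rw [hD]
  field_simp
  ring

/-- The Fourier transform of `e^(-λ|x|)` on `ℝ³`:
`∫_{ℝ³} e^(-λ|x|) e^(-i k·x) dx = 8πλ / (λ² + |k|²)²`, the integral being absolutely
convergent. -/
theorem fourier_exp_neg_mul_norm (lam : ℝ) (hlam : 0 < lam)
    (k : EuclideanSpace ℝ (Fin 3)) :
    Integrable (fun x : EuclideanSpace ℝ (Fin 3) =>
        Complex.exp (-lam * ‖x‖) * Complex.exp (-Complex.I * ⟪k, x⟫)) ∧
    ∫ x : EuclideanSpace ℝ (Fin 3),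
        Complex.exp (-lam * ‖x‖) * Complex.exp (-Complex.I * ⟪k, x⟫)
      = 8 * π * lam / (lam ^ 2 + ‖k‖ ^ 2) ^ 2 := by
  have hint : Integrable (fun x : EuclideanSpace ℝ (Fin 3) =>
      Complex.exp (-lam * ‖x‖) * Complex.exp (-Complex.I * ⟪k, x⟫)) := by
    refine (integrable_exp_neg_mul_norm hlam).mono' (by fun_prop) (ae_of_all _ fun x => ?_)
    simp [Complex.norm_exp]
  refine ⟨hint, ?_⟩
  obtain ⟨e, he⟩ := exists_linearIsometryEquiv_apply_eq
    (F := WithLp 2 (ℝ × EuclideanSpace ℝ (Fin 2))) (v := k)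
    (w := WithLp.toLp 2 (‖k‖, 0)) (by
      rw [(WithLp.linearEquiv 2 ℝ (ℝ × EuclideanSpace ℝ (Fin 2))).finrank_eq]
      simp) (by simp)
  have hmp : MeasurePreserving
      (fun p : ℝ × EuclideanSpace ℝ (Fin 2) => e.symm (WithLp.toLp 2 p)) :=
    e.symm.measurePreserving.comp (WithLp.volume_preserving_toLp ℝ (EuclideanSpace ℝ (Fin 2)))
  have hemb : MeasurableEmbedding
      (fun p : ℝ × EuclideanSpace ℝ (Fin 2) => e.symm (WithLp.toLp 2 p)) :=
    e.symm.toHomeomorph.measurableEmbedding.comp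
      (MeasurableEquiv.toLp 2 (ℝ × EuclideanSpace ℝ (Fin 2))).measurableEmbedding
  have hval : ∀ p : ℝ × EuclideanSpace ℝ (Fin 2),
      Complex.exp (-lam * ‖e.symm (WithLp.toLp 2 p)‖) *
        Complex.exp (-Complex.I * ⟪k, e.symm (WithLp.toLp 2 p)⟫) =
      (Real.exp (-lam * √(p.1 ^ 2 + ‖p.2‖ ^ 2)) : ℂ) *
        Complex.exp (-Complex.I * (‖k‖ * p.1 : ℝ)) := by
    intro p
    rw [← LinearIsometryEquiv.inner_map_eq_flip, he, LinearIsometryEquiv.norm_map,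
      WithLp.prod_norm_eq_of_L2, WithLp.prod_inner_apply]
    simp [mul_comm]
  have hint' := (hmp.integrable_comp_emb hemb).mpr hint
  rw [← hmp.integral_comp hemb]
  simp only [Function.comp_def, hval] at hint' ⊢
  rw [Measure.volume_eq_prod, integral_prod _ hint']
  have hinner : ∀ t : ℝ, ∫ y : EuclideanSpace ℝ (Fin 2),
      (Real.exp (-lam * √(t ^ 2 + ‖y‖ ^ 2)) : ℂ) * Complex.exp (-Complex.I * (‖k‖ * t : ℝ)) =
      2 * π * ((((|t| / lam + 1 / lam ^ 2) * Real.exp (-lam * |t|) : ℝ) : ℂ) *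
        Complex.exp (-Complex.I * (‖k‖ * t : ℝ))) := by
    intro t
    rw [integral_mul_const, integral_complex_ofReal, integral_exp_neg_mul_sqrt_sq_add_norm_sq hlam]
    push_cast
    ring
  simp only [hinner]
  rw [integral_const_mul, integral_abs_mul_exp_neg_mul_abs_mul_cexp hlam]
  ring
end

section
/- Let P : ℝ³ → ℂ be a polynomial function, let k ∈ ℝ³, and let ν be a natural number. Then the function F(λ) = ∫_{ℝ³} P(x) e^{−λ|x|} e^{−i k·x} dx is well defined and infinitely differentiable on (0, ∞), and its ν-th derivative satisfies F^{(ν)}(λ) = (−1)^ν ∫_{ℝ³} |x|^ν P(x) e^{−λ|x|} e^{−i k·x} dx for all λ > 0. -/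
open MeasureTheory Real
open scoped RealInnerProductSpace

/-- Polynomial growth of the evaluation of a polynomial at a point of Euclidean space. -/
lemma MvPolynomial.exists_norm_eval_ofReal_le {ι : Type*} [Fintype ι] (P : MvPolynomial ι ℂ) :
    ∃ (C : ℝ) (N : ℕ), ∀ x : EuclideanSpace ℝ ι,
      ‖MvPolynomial.eval (fun i => (x i : ℂ)) P‖ ≤ C * (1 + ‖x‖) ^ N := by
  have h : (fun x : EuclideanSpace ℝ ι =>
      MvPolynomial.eval (fun i => (x i : ℂ)) P).HasTemperateGrowth := by
    induction P using MvPolynomial.induction_on with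
    | C a => simp
    | add p q hp hq => simpa only [map_add] using! hp.add hq
    | mul_X p i hp =>
      have hi : (fun x : EuclideanSpace ℝ ι => (x i : ℂ)).HasTemperateGrowth :=
        (Complex.ofRealCLM ∘L EuclideanSpace.proj i).hasTemperateGrowth
      simpa only [map_mul, MvPolynomial.eval_X] using! hp.mul hi
  obtain ⟨N, C, hC⟩ := h.2 0
  exact ⟨C, N, fun x => by simpa using hC x⟩

section

variable {E : Type*} [NormedAddCommGroup E] [NormedSpace ℝ E] [FiniteDimensional ℝ E]
  [MeasurableSpace E] [BorelSpace E] {μ : Measure E} [μ.IsAddHaarMeasure]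

lemma integrable_one_add_norm_pow_mul_exp_neg (N : ℕ) {a : ℝ} (ha : 0 < a) :
    Integrable (fun x : E => (1 + ‖x‖) ^ N * rexp (-a * ‖x‖)) μ := by
  set d := Module.finrank ℝ E
  have hd : Integrable (fun x : E => (1 + ‖x‖) ^ (-((d + 1 : ℕ) : ℝ))) μ :=
    integrable_one_add_norm (by push_cast; linarith)
  set M := N + (d + 1)
  refine (hd.const_mul (rexp a * M.factorial / a ^ M)).mono'
    (by fun_prop) (.of_forall fun x => ?_)
  have hx : 0 < 1 + ‖x‖ := by positivity
  have key := Real.pow_div_factorial_le_exp _ (mul_pos ha hx).le M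
  rw [Real.norm_of_nonneg (by positivity), rpow_neg hx.le, rpow_natCast]
  rw [div_le_iff₀ (by positivity), mul_pow] at key
  have hexp : rexp (-a * ‖x‖) * rexp (a * (1 + ‖x‖)) = rexp a := by
    rw [← Real.exp_add]; ring_nf
  rw [← div_eq_mul_inv, le_div_iff₀ (by positivity), le_div_iff₀ (by positivity)]
  calc (1 + ‖x‖) ^ N * rexp (-a * ‖x‖) * (1 + ‖x‖) ^ (d + 1) * a ^ M
      = rexp (-a * ‖x‖) * (a ^ M * (1 + ‖x‖) ^ M) := by simp only [M, pow_add]; ring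
    _ ≤ rexp (-a * ‖x‖) * (rexp (a * (1 + ‖x‖)) * M.factorial) := by gcongr
    _ = rexp a * M.factorial := by rw [← mul_assoc, hexp]

variable {g : E → ℂ} {C : ℝ} {N : ℕ}

lemma integrable_norm_pow_mul_mul_exp_neg (hg : AEStronglyMeasurable g μ)
    (hb : ∀ x, ‖g x‖ ≤ C * (1 + ‖x‖) ^ N) (n : ℕ) {a : ℝ} (ha : 0 < a) :
    Integrable (fun x : E => (‖x‖ : ℂ) ^ n * g x * Complex.exp (-a * ‖x‖)) μ := by
  refine ((integrable_one_add_norm_pow_mul_exp_neg (n + N) ha).const_mul C).mono'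
    ?_ (.of_forall fun x => ?_)
  · exact (AEStronglyMeasurable.mul (by fun_prop) hg).mul (by fun_prop)
  · have hexp : ‖Complex.exp (-a * ‖x‖)‖ = rexp (-a * ‖x‖) := by
      rw [Complex.norm_exp]; norm_cast
    simp only [norm_mul, norm_pow, hexp, Complex.norm_real, norm_norm]
    calc ‖x‖ ^ n * ‖g x‖ * rexp (-a * ‖x‖)
        ≤ (1 + ‖x‖) ^ n * (C * (1 + ‖x‖) ^ N) * rexp (-a * ‖x‖) := by
          gcongr
          · linarith
          · exact hb x
      _ = _ := by rw [pow_add]; ring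

lemma hasDerivAt_integral_norm_pow_mul_mul_exp_neg (hg : AEStronglyMeasurable g μ)
    (hb : ∀ x, ‖g x‖ ≤ C * (1 + ‖x‖) ^ N) (n : ℕ) {a : ℝ} (ha : 0 < a) :
    HasDerivAt (fun b : ℝ => ∫ x, (‖x‖ : ℂ) ^ n * g x * Complex.exp (-b * ‖x‖) ∂μ)
      (-∫ x, (‖x‖ : ℂ) ^ (n + 1) * g x * Complex.exp (-a * ‖x‖) ∂μ) a := by
  have hint := fun (m : ℕ) {b : ℝ} (hb0 : 0 < b) =>
    integrable_norm_pow_mul_mul_exp_neg hg hb m hb0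
  rw [← integral_neg]
  refine (hasDerivAt_integral_of_dominated_loc_of_deriv_le
    (F := fun (b : ℝ) x => (‖x‖ : ℂ) ^ n * g x * Complex.exp (-b * ‖x‖))
    (F' := fun (b : ℝ) x => -((‖x‖ : ℂ) ^ (n + 1) * g x * Complex.exp (-b * ‖x‖)))
    (Ioi_mem_nhds (half_lt_self ha)) ?_ (hint n ha) (hint (n + 1) ha).aestronglyMeasurable.neg
    (.of_forall fun x b hb' => ?_) (hint (n + 1) (half_pos ha)).norm
    (.of_forall fun x b _ => ?_)).2
  · filter_upwards [Ioi_mem_nhds ha] with b hb0 using (hint n hb0).aestronglyMeasurable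
  · rw [norm_neg, norm_mul, norm_mul _ (Complex.exp _)]
    gcongr ?_ * ?_
    rw [Complex.norm_exp, Complex.norm_exp]
    have hb' : a / 2 < b := hb'
    norm_cast
    gcongr
  · have h : HasDerivAt (fun b : ℝ => (-b * ‖x‖ : ℂ)) (-1 * ‖x‖) b :=
      ((Complex.ofRealCLM.hasDerivAt (x := b)).neg).mul_const _
    convert! h.cexp.const_mul ((‖x‖ : ℂ) ^ n * g x) using 1
    ring

lemma iteratedDerivWithin_integral_mul_exp_neg (hg : AEStronglyMeasurable g μ)
    (hb : ∀ x, ‖g x‖ ≤ C * (1 + ‖x‖) ^ N) (n : ℕ) :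
    Set.EqOn
      (iteratedDerivWithin n (fun b : ℝ => ∫ x, g x * Complex.exp (-b * ‖x‖) ∂μ) (Set.Ioi 0))
      (fun b => (-1) ^ n * ∫ x, (‖x‖ : ℂ) ^ n * g x * Complex.exp (-b * ‖x‖) ∂μ)
      (Set.Ioi 0) := by
  induction n with
  | zero => intro a _; simp
  | succ n ih =>
    intro a ha
    rw [iteratedDerivWithin_succ, derivWithin_congr ih (ih ha),
      (((hasDerivAt_integral_norm_pow_mul_mul_exp_neg hg hb n ha).const_mul
        _).hasDerivWithinAt).derivWithin (uniqueDiffOn_Ioi 0 a ha)]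
    ring

lemma contDiffOn_integral_mul_exp_neg (hg : AEStronglyMeasurable g μ)
    (hb : ∀ x, ‖g x‖ ≤ C * (1 + ‖x‖) ^ N) :
    ContDiffOn ℝ (⊤ : ℕ∞) (fun b : ℝ => ∫ x, g x * Complex.exp (-b * ‖x‖) ∂μ) (Set.Ioi 0) :=
  contDiffOn_of_differentiableOn_deriv fun n _ =>
    DifferentiableOn.congr (fun _ ha => ((hasDerivAt_integral_norm_pow_mul_mul_exp_neg hg hb n
      ha).const_mul _).differentiableAt.differentiableWithinAt)
      (iteratedDerivWithin_integral_mul_exp_neg hg hb n)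

end

/-- Differentiation under the integral sign for Fourier transforms of polynomial-times-
exponential functions on `ℝ³`: for a polynomial `P`, the function
`F(λ) = ∫_{ℝ³} P(x) e^(-λ|x|) e^(-i k·x) dx` is well defined and infinitely
differentiable on `(0, ∞)`, with `ν`-th derivative
`F^(ν)(λ) = (-1)^ν ∫_{ℝ³} |x|^ν P(x) e^(-λ|x|) e^(-i k·x) dx`. -/
theorem deriv_fourier_polynomial_exp
    (P : MvPolynomial (Fin 3) ℂ) (k : EuclideanSpace ℝ (Fin 3)) (ν : ℕ) :
    (∀ lam : ℝ, 0 < lam →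
      Integrable (fun x : EuclideanSpace ℝ (Fin 3) =>
        MvPolynomial.eval (fun i => (x i : ℂ)) P * Complex.exp (-lam * ‖x‖) *
          Complex.exp (-Complex.I * ⟪k, x⟫))) ∧
    ContDiffOn ℝ (⊤ : ℕ∞)
      (fun lam : ℝ => ∫ x : EuclideanSpace ℝ (Fin 3),
        MvPolynomial.eval (fun i => (x i : ℂ)) P * Complex.exp (-lam * ‖x‖) *
          Complex.exp (-Complex.I * ⟪k, x⟫))
      (Set.Ioi 0) ∧
    (∀ lam : ℝ, 0 < lam →
      iteratedDerivWithin ν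
          (fun lam' : ℝ => ∫ x : EuclideanSpace ℝ (Fin 3),
            MvPolynomial.eval (fun i => (x i : ℂ)) P * Complex.exp (-lam' * ‖x‖) *
              Complex.exp (-Complex.I * ⟪k, x⟫))
          (Set.Ioi 0) lam
        = (-1) ^ ν * ∫ x : EuclideanSpace ℝ (Fin 3),
            (‖x‖ : ℂ) ^ ν * MvPolynomial.eval (fun i => (x i : ℂ)) P *
              Complex.exp (-lam * ‖x‖) * Complex.exp (-Complex.I * ⟪k, x⟫)) := by
  set g : EuclideanSpace ℝ (Fin 3) → ℂ := fun x =>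
    MvPolynomial.eval (fun i => (x i : ℂ)) P * Complex.exp (-Complex.I * ⟪k, x⟫) with hg_def
  have hg : AEStronglyMeasurable g volume := by
    refine Continuous.aestronglyMeasurable (.mul ?_ (by fun_prop))
    exact (MvPolynomial.continuous_eval P).comp (by fun_prop)
  obtain ⟨C, N, hC⟩ := P.exists_norm_eval_ofReal_le
  have hb : ∀ x, ‖g x‖ ≤ C * (1 + ‖x‖) ^ N := fun x => by
    have hexp : ‖Complex.exp (-Complex.I * ⟪k, x⟫)‖ = 1 := by simp [Complex.norm_exp]
    simpa only [hg_def, norm_mul, hexp, mul_one] using hC x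
  have hcomm : ∀ (b : ℝ) (x : EuclideanSpace ℝ (Fin 3)),
      MvPolynomial.eval (fun i => (x i : ℂ)) P * Complex.exp (-b * ‖x‖) *
        Complex.exp (-Complex.I * ⟪k, x⟫) = g x * Complex.exp (-b * ‖x‖) :=
    fun b x => mul_right_comm _ _ _
  simp only [hcomm]
  refine ⟨fun a ha => by simpa using integrable_norm_pow_mul_mul_exp_neg hg hb 0 ha,
    contDiffOn_integral_mul_exp_neg hg hb, fun a ha => ?_⟩
  rw [iteratedDerivWithin_integral_mul_exp_neg hg hb ν ha]
  refine congrArg ((-1) ^ ν * ·) (integral_congr_ae (.of_forall fun x => ?_))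
  simp only [hg_def]
  ring
end
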